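/- Fix θ > 0 and ξ ∈ ℝ, and define the operator D̃_ξ on Schwartz functions Ψ : ℝ² → ℂ⁴ by D̃_ξ Ψ := Σ_{μ=1,2} (I₂⊗σ^μ)(−i ∂_μ Ψ) − ξ (σ³⊗σ^μ)(x̃_μ·Ψ). Then for every Schwartz a : ℝ² → ℂ and every Schwartz Ψ : ℝ² → ℂ⁴, D̃_ξ(a ⋆ Ψ) − a ⋆ (D̃_ξ Ψ) = −i Σ_{μ=1,2} ((I₂ + ξσ³)⊗σ^μ)((∂_μ a) ⋆ Ψ); i.e. the commutator is block diagonal, acting as (1−ξ) times the standard commutator −iσ^μ((∂_μ a)⋆·) on the first ℂ² block and (1+ξ) times it on the second. -/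

import Mathlib

open MeasureTheory Complex Kronecker

noncomputable section

abbrev E2 := EuclideanSpace ℝ (Fin 2)

/-- The Moyal star product on ℝ² with deformation parameter θ. -/
def moyal (θ : ℝ) (f g : E2 → ℂ) : E2 → ℂ := fun x =>
  (((Real.pi * θ) ^ 2)⁻¹ : ℝ) • ∫ y : E2, ∫ z : E2,
    f (x + y) * g (x + z) *
      Complex.exp (-(2 * Complex.I) * ((((y 1) * (z 0) - (y 0) * (z 1)) / θ : ℝ) : ℂ))

/-- Componentwise Moyal product of a scalar function with a vector-valued function. -/
def moyalV {n : Type*} (θ : ℝ) (a : E2 → ℂ) (Ψ : E2 → n → ℂ) : E2 → n → ℂ :=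
  fun x i => moyal θ a (fun y => Ψ y i) x

/-- Partial derivative in the μ-th coordinate direction. -/
def pd {V : Type*} [NormedAddCommGroup V] [NormedSpace ℝ V] (μ : Fin 2) (f : E2 → V) :
    E2 → V := fun x => fderiv ℝ f x (EuclideanSpace.single μ (1 : ℝ))

/-- The coordinate functions `x̃₁(x) = −2x₂/θ` and `x̃₂(x) = 2x₁/θ`. -/
def xt (θ : ℝ) : Fin 2 → E2 → ℝ := ![fun x => -2 * x 1 / θ, fun x => 2 * x 0 / θ]

/-- The Pauli matrices σ¹, σ². -/
def σv : Fin 2 → Matrix (Fin 2) (Fin 2) ℂ :=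
  ![!![0, 1; 1, 0], !![0, Complex.I; -Complex.I, 0]]

/-- The Pauli matrix σ³ = iσ¹σ². -/
def σ3 : Matrix (Fin 2) (Fin 2) ℂ := !![1, 0; 0, -1]

/-- The twisted Dirac operator `D̃_ξ Ψ = Σ_μ (I₂⊗σ^μ)(−i∂_μΨ) − ξ(σ³⊗σ^μ)(x̃_μ·Ψ)`. -/
def Dtil (θ ξ : ℝ) (Ψ : E2 → Fin 2 × Fin 2 → ℂ) : E2 → Fin 2 × Fin 2 → ℂ := fun x =>
  ∑ μ : Fin 2, (((1 : Matrix (Fin 2) (Fin 2) ℂ) ⊗ₖ σv μ).mulVec ((-Complex.I) • pd μ Ψ x)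
    - ξ • (σ3 ⊗ₖ σv μ).mulVec (xt θ μ x • Ψ x))

open scoped LineDeriv SchwartzMap

/-- The oscillating phase factor `e^{-2i y·Θ⁻¹z}` of the Moyal product. -/
def moyalPhase (θ : ℝ) (y z : E2) : ℂ :=
  Complex.exp (-(2 * Complex.I) * ((((y 1) * (z 0) - (y 0) * (z 1)) / θ : ℝ) : ℂ))

lemma continuous_moyalPhase (θ : ℝ) : Continuous fun p : E2 × E2 => moyalPhase θ p.1 p.2 := by
  unfold moyalPhase
  fun_prop

lemma norm_moyalPhase (θ : ℝ) (y z : E2) : ‖moyalPhase θ y z‖ = 1 := by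
  rw [moyalPhase, Complex.norm_exp]
  simp

lemma differentiable_moyalPhase (θ : ℝ) (z : E2) : Differentiable ℝ (moyalPhase θ · z) := by
  unfold moyalPhase
  fun_prop

lemma fderiv_moyalPhase (θ : ℝ) (z y : E2) (μ : Fin 2) :
    fderiv ℝ (moyalPhase θ · z) y (EuclideanSpace.single μ 1)
      = -Complex.I * xt θ μ z * moyalPhase θ y z := by
  have hc (i : Fin 2) : HasFDerivAt (fun y : E2 => y i) (EuclideanSpace.proj i : E2 →L[ℝ] ℝ) y :=
    (EuclideanSpace.proj i : E2 →L[ℝ] ℝ).hasFDerivAt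
  have hω := ((((hc 1).mul_const (z 0)).sub ((hc 0).mul_const (z 1))).mul_const θ⁻¹)
  have h := ((Complex.ofRealCLM.hasFDerivAt.comp y hω).const_mul (-(2 * Complex.I))).cexp
  have hphase := h.congr_of_eventuallyEq (f₁ := (moyalPhase θ · z))
    (.of_forall fun y => by simp [moyalPhase, div_eq_mul_inv])
  rw [hphase.fderiv, moyalPhase]
  fin_cases μ <;> simp [xt] <;> ring_nf

lemma xt_add (θ : ℝ) (μ : Fin 2) (x y : E2) : xt θ μ (x + y) = xt θ μ x + xt θ μ y := by
  fin_cases μ <;> simp [xt] <;> ring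

lemma hasTemperateGrowth_xt (θ : ℝ) (μ : Fin 2) : (xt θ μ).HasTemperateGrowth := by
  have h (i : Fin 2) (c : ℝ) : xt θ μ = (c • EuclideanSpace.proj i : E2 →L[ℝ] ℝ) →
      (xt θ μ).HasTemperateGrowth := fun h =>
    h ▸ (c • EuclideanSpace.proj i : E2 →L[ℝ] ℝ).hasTemperateGrowth
  fin_cases μ
  · exact h 1 (-2 / θ) (by funext x; simp [xt]; ring)
  · exact h 0 (2 / θ) (by funext x; simp [xt]; ring)

/-- The Schwartz function `x ↦ x̃_μ · f(x)`. -/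
def xtMul (θ : ℝ) (μ : Fin 2) (f : 𝓢(E2, ℂ)) : 𝓢(E2, ℂ) :=
  SchwartzMap.smulLeftCLM ℂ (xt θ μ) f

lemma xtMul_apply (θ : ℝ) (μ : Fin 2) (f : 𝓢(E2, ℂ)) (x : E2) :
    xtMul θ μ f x = xt θ μ x * f x := by
  rw [xtMul, SchwartzMap.smulLeftCLM_apply_apply (hasTemperateGrowth_xt θ μ), Complex.real_smul]

lemma integrable_moyal {f g : E2 → ℂ} (hf : Integrable f) (hg : Integrable g) (θ : ℝ) (x : E2) :
    Integrable (fun p : E2 × E2 => f (x + p.1) * g (x + p.2) * moyalPhase θ p.1 p.2)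
      (volume.prod volume) :=
  ((hf.comp_add_left x).mul_prod (hg.comp_add_left x)).mul_bdd (c := 1)
    (continuous_moyalPhase θ).aestronglyMeasurable
    (.of_forall fun p => (norm_moyalPhase θ p.1 p.2).le)

lemma moyal_eq_integral_prod {f g : E2 → ℂ} (hf : Integrable f) (hg : Integrable g) (θ : ℝ)
    (x : E2) :
    moyal θ f g x = (((Real.pi * θ) ^ 2)⁻¹ : ℝ) •
      ∫ p : E2 × E2, f (x + p.1) * g (x + p.2) * moyalPhase θ p.1 p.2 ∂volume.prod volume := by
  rw [integral_prod _ (integrable_moyal hf hg θ x)]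
  rfl

lemma moyal_add {f g h : E2 → ℂ} (hf : Integrable f) (hg : Integrable g) (hh : Integrable h)
    (θ : ℝ) (x : E2) :
    moyal θ f (fun y => g y + h y) x = moyal θ f g x + moyal θ f h x := by
  have hgh : Integrable fun y => g y + h y := hg.add hh
  rw [moyal_eq_integral_prod hf hg, moyal_eq_integral_prod hf hh, moyal_eq_integral_prod hf hgh,
    ← smul_add, ← integral_add (integrable_moyal hf hg θ x) (integrable_moyal hf hh θ x)]
  simp only [mul_add, add_mul]

lemma moyal_const_mul (θ : ℝ) (f g : E2 → ℂ) (c : ℂ) (x : E2) :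
    moyal θ f (fun y => c * g y) x = c * moyal θ f g x := by
  simp only [moyal, mul_smul_comm, ← integral_const_mul]
  congr! 5
  ring

lemma moyal_sum {ι : Type*} (s : Finset ι) {f : E2 → ℂ} {g : ι → E2 → ℂ} (hf : Integrable f)
    (hg : ∀ i, Integrable (g i)) (θ : ℝ) (x : E2) :
    moyal θ f (fun y => ∑ i ∈ s, g i y) x = ∑ i ∈ s, moyal θ f (g i) x := by
  classical
  induction s using Finset.induction_on with
  | empty => simp [moyal]
  | insert i s hi ih =>
    simp only [Finset.sum_insert hi]
    rw [moyal_add hf (hg i) (integrable_finsetSum s fun j _ => hg j), ih]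

/-- `x̃_μ · (f ⋆ g) = f ⋆ (x̃_μ · g) + i (∂_μ f) ⋆ g`. -/
lemma xt_mul_moyal (θ : ℝ) (μ : Fin 2) (f g : 𝓢(E2, ℂ)) (x : E2) :
    xt θ μ x * moyal θ f g x
      = moyal θ f (xtMul θ μ g) x + Complex.I * moyal θ (pd μ f) g x := by
  set v : E2 := EuclideanSpace.single μ 1
  have hfi : Integrable f := f.integrable
  have hgi : Integrable g := g.integrable
  have hdi : Integrable (pd μ f) := (∂_{v} f).integrable
  have hxi : Integrable (xtMul θ μ g) := (xtMul θ μ g).integrable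
  have hdiff (z : E2) : Integrable fun y => pd μ f (x + y) * moyalPhase θ y z :=
    (hdi.comp_add_left x).mul_bdd (c := 1)
      (differentiable_moyalPhase θ z).continuous.aestronglyMeasurable
      (.of_forall fun y => (norm_moyalPhase θ y z).le)
  have hint (z : E2) : Integrable fun y => f (x + y) * moyalPhase θ y z :=
    (hfi.comp_add_left x).mul_bdd (c := 1)
      (differentiable_moyalPhase θ z).continuous.aestronglyMeasurable
      (.of_forall fun y => (norm_moyalPhase θ y z).le)
  have hfd (y : E2) : fderiv ℝ (fun y => f (x + y)) y v = pd μ f (x + y) := by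
    rw [fderiv_comp_add_left]; rfl
  have parts (z : E2) : ∫ y, f (x + y) * (-Complex.I * xt θ μ z * moyalPhase θ y z)
      = -∫ y, pd μ f (x + y) * moyalPhase θ y z := by
    have key := integral_mul_fderiv_eq_neg_fderiv_mul_of_integrable (μ := volume) (v := v)
      (f := fun y : E2 => f (x + y)) (g := (moyalPhase θ · z)) ?_ ?_ (hint z) ?_ ?_
    · simpa only [hfd, v, fderiv_moyalPhase] using key
    · simpa only [hfd] using hdiff z
    · simp only [v, fderiv_moyalPhase]
      convert (hint z).const_mul (-Complex.I * xt θ μ z) using 2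
      ring
    · exact fun y _ => f.differentiableAt.comp y (by fun_prop)
    · exact fun y _ => differentiable_moyalPhase θ z y
  have hsub : Integrable (fun p : E2 × E2 =>
      xt θ μ x * (f (x + p.1) * g (x + p.2) * moyalPhase θ p.1 p.2)
        - f (x + p.1) * xtMul θ μ g (x + p.2) * moyalPhase θ p.1 p.2) (volume.prod volume) :=
    ((integrable_moyal hfi hgi θ x).const_mul _).sub (integrable_moyal hfi hxi θ x)
  rw [moyal_eq_integral_prod hfi hgi, moyal_eq_integral_prod hdi hgi,
    moyal_eq_integral_prod hfi hxi, mul_smul_comm, mul_smul_comm, ← smul_add]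
  congr 1
  rw [← integral_const_mul, ← sub_eq_iff_eq_add', ← integral_sub
    ((integrable_moyal hfi hgi θ x).const_mul _) (integrable_moyal hfi hxi θ x),
    integral_prod_symm _ (integrable_moyal hdi hgi θ x),
    integral_prod_symm _ hsub, ← integral_const_mul]
  congr 1 with z
  calc _ = ∫ y, -Complex.I * g (x + z) *
        (f (x + y) * (-Complex.I * xt θ μ z * moyalPhase θ y z)) := by
        congr 1 with y
        simp only [xtMul_apply, xt_add, Complex.ofReal_add]
        linear_combination -(f (x + y) * g (x + z) * xt θ μ z * moyalPhase θ y z) * Complex.I_mul_I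
    _ = Complex.I * ∫ y, g (x + z) * (pd μ f (x + y) * moyalPhase θ y z) := by
        rw [integral_const_mul, parts, integral_const_mul]
        ring
    _ = _ := by
        congr 2 with y
        ring

lemma exists_norm_translate_le {V : Type*} [NormedAddCommGroup V] [NormedSpace ℝ V]
    (h : 𝓢(E2, V)) (x₀ : E2) :
    ∃ C, 0 ≤ C ∧ ∀ x ∈ Metric.ball x₀ 1, ∀ y, ‖h (x + y)‖ ≤ C * (1 + ‖y‖) ^ (-(3 : ℝ)) := by
  obtain ⟨C, hC⟩ : ∃ C, ∀ x, (1 + ‖x‖) ^ 3 * ‖h x‖ ≤ C :=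
    ⟨_, fun x => by
      simpa using SchwartzMap.one_add_le_sup_seminorm_apply (𝕜 := ℝ) (m := (3, 0)) le_rfl le_rfl h x⟩
  have hC0 : 0 ≤ C := le_trans (by positivity) (hC 0)
  refine ⟨(2 + ‖x₀‖) ^ 3 * C, by positivity, fun x hx y => ?_⟩
  have hx' : ‖x‖ ≤ 1 + ‖x₀‖ := by
    rw [mem_ball_iff_norm] at hx
    linarith [norm_le_insert' x x₀]
  have hy : 1 + ‖y‖ ≤ (2 + ‖x₀‖) * (1 + ‖x + y‖) := by
    have : ‖y‖ ≤ ‖x + y‖ + ‖x‖ := by simpa using norm_sub_le (x + y) x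
    nlinarith [norm_nonneg (x + y), norm_nonneg x₀]
  rw [Real.rpow_neg (by positivity), ← div_eq_mul_inv, le_div_iff₀ (by positivity)]
  norm_cast
  calc ‖h (x + y)‖ * (1 + ‖y‖) ^ 3
      ≤ ‖h (x + y)‖ * ((2 + ‖x₀‖) * (1 + ‖x + y‖)) ^ 3 := by gcongr
    _ = (2 + ‖x₀‖) ^ 3 * ((1 + ‖x + y‖) ^ 3 * ‖h (x + y)‖) := by ring
    _ ≤ _ := by gcongr; exact hC _

/-- The Leibniz rule for the Moyal product. -/
lemma hasFDerivAt_moyal (θ : ℝ) (f g : 𝓢(E2, ℂ)) (x₀ : E2) :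
    ∃ L : E2 →L[ℝ] ℂ, HasFDerivAt (moyal θ f g) L x₀ ∧
      ∀ μ, L (EuclideanSpace.single μ 1) = moyal θ (pd μ f) g x₀ + moyal θ f (pd μ g) x₀ := by
  have hfi : Integrable f := f.integrable
  have hgi : Integrable g := g.integrable
  set F : E2 → E2 × E2 → ℂ := fun x p => f (x + p.1) * g (x + p.2) * moyalPhase θ p.1 p.2
  set F' : E2 → E2 × E2 → E2 →L[ℝ] ℂ := fun x p => moyalPhase θ p.1 p.2 •
    (f (x + p.1) • fderiv ℝ g (x + p.2) + g (x + p.2) • fderiv ℝ f (x + p.1))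
  obtain ⟨A, hA0, hA⟩ := exists_norm_translate_le f x₀
  obtain ⟨B, hB0, hB⟩ := exists_norm_translate_le g x₀
  obtain ⟨A', hA0', hA'⟩ := exists_norm_translate_le (SchwartzMap.fderivCLM ℝ E2 ℂ f) x₀
  obtain ⟨B', hB0', hB'⟩ := exists_norm_translate_le (SchwartzMap.fderivCLM ℝ E2 ℂ g) x₀
  simp only [SchwartzMap.fderivCLM_apply] at hA' hB'
  set bound : E2 × E2 → ℝ := fun p =>
    (A * B' + B * A') * ((1 + ‖p.1‖) ^ (-(3 : ℝ)) * (1 + ‖p.2‖) ^ (-(3 : ℝ)))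
  have hdecay : Integrable fun y : E2 => (1 + ‖y‖) ^ (-(3 : ℝ)) :=
    integrable_one_add_norm (by simp; norm_num)
  have hbound_int : Integrable bound (volume.prod volume) :=
    (hdecay.mul_prod hdecay).const_mul _
  have hbound (p : E2 × E2) (x : E2) (hx : x ∈ Metric.ball x₀ 1) : ‖F' x p‖ ≤ bound p := by
    simp only [F', norm_smul, norm_moyalPhase, one_mul]
    refine (norm_add_le _ _).trans ?_
    rw [norm_smul, norm_smul]
    calc _ ≤ A * (1 + ‖p.1‖) ^ (-(3 : ℝ)) * (B' * (1 + ‖p.2‖) ^ (-(3 : ℝ)))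
          + B * (1 + ‖p.2‖) ^ (-(3 : ℝ)) * (A' * (1 + ‖p.1‖) ^ (-(3 : ℝ))) := by
          gcongr
          exacts [hA x hx _, hB' x hx _, hB x hx _, hA' x hx _]
      _ = _ := by simp only [bound]; ring
  have hmeas : AEStronglyMeasurable (F' x₀) (volume.prod volume) := by
    have hf' : Continuous (fderiv ℝ f) := (SchwartzMap.fderivCLM ℝ E2 ℂ f).continuous
    have hg' : Continuous (fderiv ℝ g) := (SchwartzMap.fderivCLM ℝ E2 ℂ g).continuous
    have hf := f.continuous
    have hg := g.continuous
    have he := continuous_moyalPhase θ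
    exact Continuous.aestronglyMeasurable (by fun_prop)
  have hF'int : Integrable (F' x₀) (volume.prod volume) :=
    hbound_int.mono' hmeas (.of_forall fun p => hbound p x₀ (Metric.mem_ball_self one_pos))
  have hF (p : E2 × E2) (x : E2) : HasFDerivAt (F · p) (F' x p) x := by
    have h1 : HasFDerivAt (fun x => f (x + p.1)) (fderiv ℝ f (x + p.1)) x :=
      (hasFDerivAt_comp_add_right p.1).2 f.differentiableAt.hasFDerivAt
    have h2 : HasFDerivAt (fun x => g (x + p.2)) (fderiv ℝ g (x + p.2)) x :=
      (hasFDerivAt_comp_add_right p.2).2 g.differentiableAt.hasFDerivAt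
    exact (h1.mul h2).mul_const _
  have hderiv := hasFDerivAt_integral_of_dominated_of_fderiv_le
    (Metric.ball_mem_nhds x₀ one_pos)
    (.of_forall fun x => (integrable_moyal hfi hgi θ x).aestronglyMeasurable)
    (integrable_moyal hfi hgi θ x₀) hmeas (.of_forall hbound) hbound_int
    (.of_forall fun p x _ => hF p x)
  refine ⟨_, (hderiv.const_smul (((Real.pi * θ) ^ 2)⁻¹ : ℝ)).congr_of_eventuallyEq
    (.of_forall fun x => moyal_eq_integral_prod hfi hgi θ x), fun μ => ?_⟩
  set v : E2 := EuclideanSpace.single μ 1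
  have hdf : Integrable (pd μ f) := (∂_{v} f).integrable
  have hdg : Integrable (pd μ g) := (∂_{v} g).integrable
  rw [moyal_eq_integral_prod hdf hgi, moyal_eq_integral_prod hfi hdg, ← smul_add,
    ← integral_add (integrable_moyal hdf hgi θ x₀) (integrable_moyal hfi hdg θ x₀),
    smul_apply, ContinuousLinearMap.integral_apply hF'int]
  congr 2 with p
  simp only [F', pd, v, smul_apply, add_apply, smul_eq_mul]
  ring

/-- The `j`-th component of a vector-valued Schwartz function. -/
def schwartzComponent {n : Type*} [Fintype n] (Ψ : 𝓢(E2, n → ℂ)) (j : n) : 𝓢(E2, ℂ) :=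
  Ψ.postcompCLM (ContinuousLinearMap.proj (R := ℝ) j)

lemma pd_schwartz_apply {n : Type*} [Fintype n] (Ψ : 𝓢(E2, n → ℂ)) (μ : Fin 2) (x : E2) (j : n) :
    pd μ Ψ x j = pd μ (schwartzComponent Ψ j) x := by
  have h := hasFDerivAt_pi'.1 (Ψ.differentiableAt (x := x)).hasFDerivAt j
  have h' : HasFDerivAt (schwartzComponent Ψ j) _ x := h
  rw [pd, pd, h'.fderiv]
  rfl

lemma pd_moyalV_apply {n : Type*} [Fintype n] (θ : ℝ) (a : 𝓢(E2, ℂ)) (Ψ : 𝓢(E2, n → ℂ))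
    (μ : Fin 2) (x : E2) (j : n) :
    pd μ (moyalV θ a Ψ) x j
      = moyalV θ (pd μ a) Ψ x j + moyal θ a (pd μ (schwartzComponent Ψ j)) x := by
  choose L hL hLv using fun i => hasFDerivAt_moyal θ a (schwartzComponent Ψ i) x
  have h : HasFDerivAt (moyalV θ a Ψ) (ContinuousLinearMap.pi L) x := hasFDerivAt_pi.2 hL
  rw [pd, h.fderiv]
  exact hLv j μ

lemma moyalV_Dtil (θ ξ : ℝ) (a : 𝓢(E2, ℂ)) (Ψ : 𝓢(E2, Fin 2 × Fin 2 → ℂ)) (x : E2)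
    (i : Fin 2 × Fin 2) :
    moyalV θ a (Dtil θ ξ Ψ) x i = ∑ μ, ∑ j,
      (-Complex.I * ((1 : Matrix (Fin 2) (Fin 2) ℂ) ⊗ₖ σv μ) i j *
          moyal θ a (pd μ (schwartzComponent Ψ j)) x
        + -ξ * (σ3 ⊗ₖ σv μ) i j * moyal θ a (xtMul θ μ (schwartzComponent Ψ j)) x) := by
  have hD : (fun y => Dtil θ ξ Ψ y i) = fun y => ∑ μ, ∑ j,
      (-Complex.I * ((1 : Matrix (Fin 2) (Fin 2) ℂ) ⊗ₖ σv μ) i j *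
          pd μ (schwartzComponent Ψ j) y
        + -ξ * (σ3 ⊗ₖ σv μ) i j * xtMul θ μ (schwartzComponent Ψ j) y) := by
    funext y
    simp only [Dtil, Finset.sum_apply, Pi.sub_apply, Pi.smul_apply, Matrix.mulVec, dotProduct,
      smul_eq_mul, Complex.real_smul, Finset.mul_sum, ← Finset.sum_sub_distrib,
      pd_schwartz_apply, xtMul_apply]
    refine Finset.sum_congr rfl fun μ _ => Finset.sum_congr rfl fun j _ => ?_
    rw [show schwartzComponent Ψ j y = Ψ y j from rfl]
    ring
  have ha : Integrable a := a.integrable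
  have hd (μ j) (c : ℂ) : Integrable fun y => c * pd μ (schwartzComponent Ψ j) y :=
    (∂_{(EuclideanSpace.single μ 1 : E2)} (schwartzComponent Ψ j)).integrable.const_mul c
  have hx (μ j) (c : ℂ) : Integrable fun y => c * xtMul θ μ (schwartzComponent Ψ j) y :=
    (xtMul θ μ (schwartzComponent Ψ j)).integrable.const_mul c
  have hdx (μ j) (c d : ℂ) : Integrable fun y =>
      c * pd μ (schwartzComponent Ψ j) y + d * xtMul θ μ (schwartzComponent Ψ j) y :=
    (hd μ j c).add (hx μ j d)
  rw [moyalV, hD, moyal_sum _ ha fun μ => integrable_finsetSum _ fun j _ => hdx μ j _ _]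
  refine Finset.sum_congr rfl fun μ _ => ?_
  rw [moyal_sum _ ha fun j => hdx μ j _ _]
  refine Finset.sum_congr rfl fun j _ => ?_
  rw [moyal_add ha (hd μ j _) (hx μ j _), moyal_const_mul, moyal_const_mul]

/-- The commutator of `D̃_ξ` with left Moyal multiplication is block diagonal:
`D̃_ξ(a ⋆ Ψ) − a ⋆ (D̃_ξΨ) = −i Σ_μ ((I₂ + ξσ³)⊗σ^μ)((∂_μ a) ⋆ Ψ)`. -/
theorem Dtil_commutator (θ : ℝ) (hθ : 0 < θ) (ξ : ℝ)
    (a : SchwartzMap E2 ℂ) (Ψ : SchwartzMap E2 (Fin 2 × Fin 2 → ℂ)) :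
    ∀ x : E2, Dtil θ ξ (moyalV θ (⇑a) (⇑Ψ)) x - moyalV θ (⇑a) (Dtil θ ξ (⇑Ψ)) x
      = (-Complex.I) • ∑ μ : Fin 2,
          (((1 : Matrix (Fin 2) (Fin 2) ℂ) + (ξ : ℂ) • σ3) ⊗ₖ σv μ).mulVec
            (moyalV θ (pd μ (⇑a)) (⇑Ψ) x) := by
  intro x
  funext i
  rw [Pi.sub_apply, moyalV_Dtil]
  simp only [Dtil, Finset.sum_apply, Pi.sub_apply, Pi.smul_apply, Matrix.mulVec, dotProduct,
    smul_eq_mul, Complex.real_smul, Finset.mul_sum, ← Finset.sum_sub_distrib, pd_moyalV_apply]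
  refine Finset.sum_congr rfl fun μ _ => Finset.sum_congr rfl fun j _ => ?_
  have h : xt θ μ x * moyalV θ a Ψ x j = moyal θ a (xtMul θ μ (schwartzComponent Ψ j)) x
      + Complex.I * moyalV θ (pd μ a) Ψ x j := xt_mul_moyal θ μ a (schwartzComponent Ψ j) x
  rw [Matrix.add_kronecker, Matrix.smul_kronecker, Matrix.add_apply, Matrix.smul_apply, smul_eq_mul]
  linear_combination (-ξ * (σ3 ⊗ₖ σv μ) i j) * h

end
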